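/- Let α > 0 and assume the standing hypotheses (H1)–(H3) with constant d ∈ [0,1). Then there exists M(α) > 0 such that for every integer n > 1 + M(α)/(2−2d) and every positive solution (u₁,…,u_n) ∈ (0,∞)ⁿ of the discrete system (Sα) (defined with this n), the Jacobian matrix J(α,u) is symmetric and positive definite. -/

import Mathlib

noncomputable section

/-- `Useq g1 h k` is the function `U_{k+1}` (0-indexed version of the recursion). -/
def Useq (g1 : ℝ → ℝ) (h : ℝ) : ℕ → ℝ → ℝ
  | 0 => fun x => x
  | 1 => fun x => x + h ^ 2 / 2 * g1 x
  | k + 2 => fun x =>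
      2 * Useq g1 h (k + 1) x - Useq g1 h k x + h ^ 2 * g1 (Useq g1 h (k + 1) x)

/-- `discU g1 h k` is the function `U_k` from the paper, for `1 ≤ k`. -/
def discU (g1 : ℝ → ℝ) (h : ℝ) (k : ℕ) : ℝ → ℝ := Useq g1 h (k - 1)

/-- The function `A(u₁)` from the paper. -/
def discA (g1 g2 : ℝ → ℝ) (h : ℝ) (n : ℕ) (x : ℝ) : ℝ :=
  ((discU g1 h n x - discU g1 h (n - 1) x) / h + h / 2 * g1 (discU g1 h n x)) /
    g2 (discU g1 h n x)

/-- `(u₁, …, u_n)` (encoded as `u : ℕ → ℝ` on indices `1,…,n`) is a positive solution of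
the discrete system `(Sα)`. -/
def IsSolution (g1 g2 : ℝ → ℝ) (n : ℕ) (h α : ℝ) (u : ℕ → ℝ) : Prop :=
  (∀ k, 1 ≤ k → k ≤ n → 0 < u k) ∧
  u 2 - u 1 = h ^ 2 / 2 * g1 (u 1) ∧
  (∀ k, 2 ≤ k → k ≤ n - 1 → u (k + 1) - 2 * u k + u (k - 1) = h ^ 2 * g1 (u k)) ∧
  u n - u (n - 1) = -(h ^ 2 / 2) * g1 (u n) + h * α * g2 (u n)

/-- `G₁`, the primitive of `g₁` vanishing at `0`. -/
def primG1 (g1 : ℝ → ℝ) (x : ℝ) : ℝ := ∫ t in (0:ℝ)..x, g1 t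

/-- `g := g₁/g₂`. -/
def gg (g1 g2 : ℝ → ℝ) (x : ℝ) : ℝ := g1 x / g2 x

/-- `G := G₁/g₂²`. -/
def GG (g1 g2 : ℝ → ℝ) (x : ℝ) : ℝ := primG1 g1 x / (g2 x) ^ 2

/-- The trapezoidal-rule error `E` as a function of `u₁`. -/
def trapError (g1 : ℝ → ℝ) (h : ℝ) (n : ℕ) (x : ℝ) : ℝ :=
  (∑ k ∈ Finset.Icc 1 (n - 1),
    (g1 (discU g1 h k x) + g1 (discU g1 h (k + 1) x)) / 2 *
      (discU g1 h (k + 1) x - discU g1 h k x)) -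
  (primG1 g1 (discU g1 h n x) - primG1 g1 (discU g1 h 1 x))

/-- The Jacobian matrix `J(α,u)` of the system `(Sα)`. -/
def Jmat (g1 g2 : ℝ → ℝ) (n : ℕ) (h α : ℝ) (u : ℕ → ℝ) : Matrix (Fin n) (Fin n) ℝ :=
  Matrix.of fun i j =>
    if i = j then
      (if (i : ℕ) = 0 then 1 + h ^ 2 / 2 * deriv g1 (u 1)
       else if (i : ℕ) = n - 1 then
         1 + h ^ 2 / 2 * deriv g1 (u n) - h * α * deriv g2 (u n)
       else 2 + h ^ 2 * deriv g1 (u ((i : ℕ) + 1)))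
    else if (i : ℕ) + 1 = (j : ℕ) ∨ (j : ℕ) + 1 = (i : ℕ) then -1 else 0

/-- A symmetric matrix with nonpositive off-diagonal entries that maps some positive vector to a
positive vector is positive definite. -/
theorem posDef_of_pos_mulVec {ι : Type*} [Fintype ι] (A : Matrix ι ι ℝ)
    (hA : A.IsSymm) (hoff : ∀ i j, i ≠ j → A i j ≤ 0) (w : ι → ℝ) (hw : ∀ i, 0 < w i)
    (hAw : ∀ i, 0 < ∑ j, A i j * w j) : A.PosDef := by
  have hsym : ∀ i j, A j i = A i j := fun i j => hA.apply i j
  refine Matrix.PosDef.of_dotProduct_mulVec_pos ?_ ?_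
  · ext i j
    simp [Matrix.conjTranspose_apply, hsym]
  · intro x hx
    have hquad : star x ⬝ᵥ A.mulVec x = ∑ i, ∑ j, A i j * (x i * x j) := by
      simp only [dotProduct, Matrix.mulVec, Finset.mul_sum, star_trivial]
      exact Finset.sum_congr rfl fun i _ => Finset.sum_congr rfl fun j _ => by ring
    have hterm : ∀ i j,
        A i j * (w j / w i * x i ^ 2) / 2 + A i j * (w i / w j * x j ^ 2) / 2
          ≤ A i j * (x i * x j) := by
      intro i j
      have hi := hw i
      have hj := hw j
      rcases eq_or_ne i j with rfl | hij
      · rw [div_self hi.ne']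
        apply le_of_eq
        ring
      · have hamgm : x i * x j ≤ (w j / w i * x i ^ 2 + w i / w j * x j ^ 2) / 2 := by
          have : (w j / w i * x i ^ 2 + w i / w j * x j ^ 2) / 2 - x i * x j
              = (w j * x i - w i * x j) ^ 2 / (2 * w i * w j) := by
            field_simp
            ring
          have h0 : 0 ≤ (w j * x i - w i * x j) ^ 2 / (2 * w i * w j) := by positivity
          linarith
        have := mul_le_mul_of_nonpos_left hamgm (hoff i j hij)
        linarith
    have hsum : ∑ i, x i ^ 2 / w i * ∑ j, A i j * w j
        = ∑ i, ∑ j, (A i j * (w j / w i * x i ^ 2) / 2 + A i j * (w i / w j * x j ^ 2) / 2) := by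
      simp only [Finset.sum_add_distrib]
      have hswap : ∑ i, ∑ j, A i j * (w i / w j * x j ^ 2) / 2
          = ∑ i, ∑ j, A i j * (w j / w i * x i ^ 2) / 2 := by
        rw [Finset.sum_comm]
        exact Finset.sum_congr rfl fun i _ => Finset.sum_congr rfl fun j _ => by rw [hsym]
      rw [hswap, ← Finset.sum_add_distrib]
      refine Finset.sum_congr rfl fun i _ => ?_
      rw [Finset.mul_sum, ← Finset.sum_add_distrib]
      exact Finset.sum_congr rfl fun j _ => by ring
    rw [hquad]
    refine lt_of_lt_of_le ?_ (Finset.sum_le_sum fun i _ => Finset.sum_le_sum fun j _ => hterm i j)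
    rw [← hsum]
    obtain ⟨k, hk⟩ := Function.ne_iff.mp hx
    have hk' : x k ≠ 0 := hk
    refine Finset.sum_pos' (fun i _ => ?_) ⟨k, Finset.mem_univ k, ?_⟩
    · exact mul_nonneg (div_nonneg (sq_nonneg _) (hw i).le) (hAw i).le
    · exact mul_pos (div_pos (by positivity) (hw k)) (hAw k)

/-- Quadratic upper bound for a function whose second derivative is at most `B` between
`x` and `y`. -/
theorem le_quadratic_of_second_deriv_le {f : ℝ → ℝ} (hf : ContDiff ℝ 2 f) {x y B : ℝ}
    (hB : ∀ t ∈ Set.uIcc x y, deriv (deriv f) t ≤ B) :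
    f y ≤ f x + deriv f x * (y - x) + B / 2 * (y - x) ^ 2 := by
  have hf1 : Differentiable ℝ f := hf.differentiable (by norm_num)
  have hf2 : Differentiable ℝ (deriv f) :=
    (((contDiff_succ_iff_deriv (n := 1)).1 hf).2.2).differentiable (by norm_num)
  let q : ℝ → ℝ := fun t => f t - deriv f x * (t - x) - B / 2 * (t - x) ^ 2
  have hq : ∀ t, HasDerivAt q (deriv f t - deriv f x - B * (t - x)) t := by
    intro t
    have h1 := (((hf1 t).hasDerivAt.sub
      (((hasDerivAt_id t).sub_const x).const_mul (deriv f x))).sub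
      ((((hasDerivAt_id t).sub_const x).pow 2).const_mul (B / 2)))
    refine h1.congr_deriv ?_
    simp
    ring
  let r : ℝ → ℝ := fun t => deriv f t - deriv f x - B * (t - x)
  have hr : ∀ t, HasDerivAt r (deriv (deriv f) t - B) t := by
    intro t
    have h1 := (((hf2 t).hasDerivAt.sub_const (deriv f x)).sub
      (((hasDerivAt_id t).sub_const x).const_mul B))
    refine h1.congr_deriv ?_
    simp
  have hranti : AntitoneOn r (Set.uIcc x y) := by
    refine antitoneOn_of_deriv_nonpos (convex_uIcc x y)
      (fun t _ => (hr t).continuousAt.continuousWithinAt)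
      (fun t _ => (hr t).differentiableAt.differentiableWithinAt) fun t ht => ?_
    rw [(hr t).deriv]
    linarith [hB t (interior_subset ht)]
  have hrx : r x = 0 := by simp [r]
  have hqxy : q y ≤ q x := by
    rcases le_total x y with hxy | hxy
    · have : AntitoneOn q (Set.Icc x y) := by
        refine antitoneOn_of_deriv_nonpos (convex_Icc x y)
          (fun t _ => (hq t).continuousAt.continuousWithinAt)
          (fun t _ => (hq t).differentiableAt.differentiableWithinAt) fun t ht => ?_
        have ht' := interior_subset ht
        rw [(hq t).deriv]
        rw [Set.uIcc_of_le hxy] at hranti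
        have := hranti (Set.left_mem_Icc.2 hxy) ht' ht'.1
        rw [hrx] at this
        exact this
      exact this (Set.left_mem_Icc.2 hxy) (Set.right_mem_Icc.2 hxy) hxy
    · have : MonotoneOn q (Set.Icc y x) := by
        refine monotoneOn_of_deriv_nonneg (convex_Icc y x)
          (fun t _ => (hq t).continuousAt.continuousWithinAt)
          (fun t _ => (hq t).differentiableAt.differentiableWithinAt) fun t ht => ?_
        have ht' := interior_subset ht
        rw [(hq t).deriv]
        rw [Set.uIcc_of_ge hxy] at hranti
        have := hranti ht' (Set.right_mem_Icc.2 hxy) ht'.2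
        rw [hrx] at this
        exact this
      exact this (Set.left_mem_Icc.2 hxy) (Set.right_mem_Icc.2 hxy) hxy
  have hqx : q x = f x := by simp [q]
  rw [hqx] at hqxy
  have hqy : q y = f y - deriv f x * (y - x) - B / 2 * (y - x) ^ 2 := rfl
  linarith

theorem monotoneOn_Ici_of_deriv_pos {f : ℝ → ℝ} (hf : Differentiable ℝ f)
    (h : ∀ x > (0 : ℝ), 0 ≤ deriv f x) : MonotoneOn f (Set.Ici 0) := by
  refine monotoneOn_of_deriv_nonneg (convex_Ici 0) hf.continuous.continuousOn
    hf.differentiableOn fun x hx => ?_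
  rw [interior_Ici] at hx
  exact h x hx

theorem pos_of_deriv_pos {f : ℝ → ℝ} (hf : Differentiable ℝ f) (h0 : f 0 = 0)
    (h : ∀ x > (0 : ℝ), 0 < deriv f x) {x : ℝ} (hx : 0 < x) : 0 < f x := by
  have : StrictMonoOn f (Set.Ici 0) := by
    refine strictMonoOn_of_deriv_pos (convex_Ici 0) hf.continuous.continuousOn fun x hx => ?_
    rw [interior_Ici] at hx
    exact h x hx
  simpa [h0] using this Set.self_mem_Ici hx.le hx

theorem hasDerivAt_primG1 {g1 : ℝ → ℝ} (hg : Continuous g1) (x : ℝ) :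
    HasDerivAt (primG1 g1) (g1 x) x :=
  intervalIntegral.integral_hasDerivAt_right (hg.intervalIntegrable _ _)
    (hg.stronglyMeasurableAtFilter _ _) hg.continuousAt

/-- Left and right endpoint rules bound the increments of the primitive of a monotone function. -/
theorem primG1_sub_bounds {g1 : ℝ → ℝ} (hg : Continuous g1) (hm : MonotoneOn g1 (Set.Ici 0))
    {x y : ℝ} (hx : 0 ≤ x) (hxy : x ≤ y) :
    g1 x * (y - x) ≤ primG1 g1 y - primG1 g1 x ∧ primG1 g1 y - primG1 g1 x ≤ g1 y * (y - x) := by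
  rcases hxy.eq_or_lt with rfl | hlt
  · simp
  obtain ⟨c, hc, hcd⟩ := exists_hasDerivAt_eq_slope (primG1 g1) g1 hlt
    (fun t _ => (hasDerivAt_primG1 hg t).continuousAt.continuousWithinAt)
    (fun t _ => hasDerivAt_primG1 hg t)
  have hyx : 0 < y - x := sub_pos.2 hlt
  rw [eq_div_iff hyx.ne'] at hcd
  rw [← hcd]
  have hc0 : 0 ≤ c := hx.trans hc.1.le
  exact ⟨mul_le_mul_of_nonneg_right (hm hx hc0 hc.1.le) hyx.le,
    mul_le_mul_of_nonneg_right (hm hc0 (hx.trans hxy) hc.2.le) hyx.le⟩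

/-- The functions `g2 ∘ u` are strict supersolutions of the linearized equation: convexity of
`G₁/g₂²` written out in terms of `g₁`, `g₂` and their derivatives. -/
theorem supersolution_inequality {g1 g2 : ℝ → ℝ}
    (hg1 : Continuous g1) (hg1' : Differentiable ℝ g1) (hg2 : Differentiable ℝ g2)
    (hg2' : Differentiable ℝ (deriv g2)) (hpos : ∀ x > (0 : ℝ), 0 < g2 x)
    (hpos' : ∀ x > (0 : ℝ), 0 < deriv g2 x)
    (hG1 : ∀ x > (0 : ℝ), 0 < primG1 g1 x) {d : ℝ}
    (hH2 : ∀ x > (0:ℝ), 0 ≤ d * g1 x / primG1 g1 x - 2 * deriv g2 x / g2 x)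
    (hH3 : ∀ x > (0:ℝ), 0 ≤ deriv (deriv (GG g1 g2)) x) {x : ℝ} (hx : 0 < x) :
    deriv g2 x * g1 x + 2 * deriv (deriv g2) x * primG1 g1 x
      + 3 * (1 - d) * (g1 x * deriv g2 x) ≤ deriv g1 x * g2 x := by
  have hG : ∀ y > (0 : ℝ), HasDerivAt (GG g1 g2)
      (g1 y / g2 y ^ 2 - 2 * primG1 g1 y * deriv g2 y / g2 y ^ 3) y := by
    intro y hy
    have h2 := (hpos y hy).ne'
    refine ((hasDerivAt_primG1 hg1 y).div ((hg2 y).hasDerivAt.pow 2)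
      (pow_ne_zero 2 h2)).congr_deriv ?_
    simp only [Pi.pow_apply]
    field_simp
    ring
  have hev : deriv (GG g1 g2) =ᶠ[nhds x]
      fun y => g1 y / g2 y ^ 2 - 2 * primG1 g1 y * deriv g2 y / g2 y ^ 3 := by
    filter_upwards [lt_mem_nhds hx] with y hy using (hG y hy).deriv
  have h2 := hpos x hx
  have hp := hpos' x hx
  have hGp := hG1 x hx
  have hsecond : HasDerivAt
      (fun y => g1 y / g2 y ^ 2 - 2 * primG1 g1 y * deriv g2 y / g2 y ^ 3)
      ((deriv g1 x * g2 x - 4 * g1 x * deriv g2 x - 2 * primG1 g1 x * deriv (deriv g2) x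
        + 6 * primG1 g1 x * deriv g2 x ^ 2 / g2 x) / g2 x ^ 3) x := by
    have h3 := ((hg1' x).hasDerivAt.div ((hg2 x).hasDerivAt.pow 2) (pow_ne_zero 2 h2.ne')).sub
      ((((hasDerivAt_primG1 hg1 x).const_mul 2).mul (hg2' x).hasDerivAt).div
        ((hg2 x).hasDerivAt.pow 3) (pow_ne_zero 3 h2.ne'))
    refine h3.congr_deriv ?_
    simp only [Pi.pow_apply, Pi.mul_apply]
    field_simp
    ring
  have h3 := hH3 x hx
  rw [hev.deriv_eq, hsecond.deriv, le_div_iff₀ (by positivity), zero_mul] at h3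
  have hle : 2 * primG1 g1 x * deriv g2 x / g2 x ≤ d * g1 x := by
    have h4 := mul_nonneg (hH2 x hx) hGp.le
    have h5 : (d * g1 x / primG1 g1 x - 2 * deriv g2 x / g2 x) * primG1 g1 x
        = d * g1 x - 2 * primG1 g1 x * deriv g2 x / g2 x := by
      field_simp
    linarith
  have h6 := mul_le_mul_of_nonneg_right hle (by positivity : 0 ≤ 3 * deriv g2 x)
  have h7 : 2 * primG1 g1 x * deriv g2 x / g2 x * (3 * deriv g2 x)
      = 6 * primG1 g1 x * deriv g2 x ^ 2 / g2 x := by ring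
  nlinarith

/-- Application of the tridiagonal Jacobian to a vector, row by row. -/
theorem sum_Jmat_row {g1 g2 : ℝ → ℝ} {n : ℕ} {h α : ℝ} {u : ℕ → ℝ} (hn : 2 ≤ n) (i : Fin n)
    (f : ℕ → ℝ) :
    ∑ j, Jmat g1 g2 n h α u i j * f ((j : ℕ) + 1) =
      if (i : ℕ) = 0 then (1 + h ^ 2 / 2 * deriv g1 (u 1)) * f 1 - f 2
      else if (i : ℕ) = n - 1 then
        (1 + h ^ 2 / 2 * deriv g1 (u n) - h * α * deriv g2 (u n)) * f n - f (n - 1)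
      else (2 + h ^ 2 * deriv g1 (u ((i : ℕ) + 1))) * f ((i : ℕ) + 1)
        - f ((i : ℕ) + 2) - f (i : ℕ) := by
  obtain ⟨i, hi⟩ := i
  have hentry : ∀ j : Fin n, Jmat g1 g2 n h α u ⟨i, hi⟩ j * f ((j : ℕ) + 1) =
      (if i = (j : ℕ) then (if i = 0 then 1 + h ^ 2 / 2 * deriv g1 (u 1)
        else if i = n - 1 then 1 + h ^ 2 / 2 * deriv g1 (u n) - h * α * deriv g2 (u n)
        else 2 + h ^ 2 * deriv g1 (u (i + 1))) * f (i + 1) else 0)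
      - (if i + 1 = (j : ℕ) then f (i + 2) else 0) - (if (j : ℕ) + 1 = i then f i else 0) := by
    rintro ⟨j, hj⟩
    simp only [Jmat, Matrix.of_apply, Fin.mk.injEq]
    by_cases h1 : i = j
    · subst h1
      simp
    by_cases h2 : i + 1 = j
    · subst h2
      simp [show ¬ (i + 1 + 1 = i) by omega]
    by_cases h3 : j + 1 = i
    · subst h3
      simp [show ¬ (j + 1 + 1 = j) by omega]
    simp [h1, h2, h3]
  rw [Finset.sum_congr rfl fun j _ => hentry j, Finset.sum_sub_distrib, Finset.sum_sub_distrib,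
    Fin.sum_univ_eq_sum_range (fun j => if i = j then _ else (0 : ℝ)) n,
    Fin.sum_univ_eq_sum_range (fun j => if i + 1 = j then f (i + 2) else 0) n,
    Fin.sum_univ_eq_sum_range (fun j => if j + 1 = i then f i else 0) n,
    Finset.sum_ite_eq, Finset.sum_ite_eq]
  simp only [Finset.mem_range, hi, if_true]
  rcases Nat.eq_zero_or_pos i with rfl | hi0
  · simp [show 1 < n by omega]
  · obtain ⟨k, rfl⟩ : ∃ k, i = k + 1 := ⟨i - 1, by omega⟩
    simp only [Nat.add_right_cancel_iff, Finset.sum_ite_eq', Finset.mem_range,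
      show k < n by omega, if_true]
    by_cases hkn : k + 1 = n - 1
    · obtain rfl : n = k + 2 := by omega
      simp
    · simp [hkn, show k + 1 + 1 < n by omega]

section Solution

variable {g1 g2 : ℝ → ℝ} {n : ℕ} {h α : ℝ} {u : ℕ → ℝ}

theorem IsSolution.step (hu : IsSolution g1 g2 n h α u) {k : ℕ} (hk : 1 ≤ k) (hkn : k + 2 ≤ n) :
    u (k + 2) - u (k + 1) = u (k + 1) - u k + h ^ 2 * g1 (u (k + 1)) := by
  have := hu.2.2.1 (k + 1) (by omega) (by omega)
  rw [show k + 1 + 1 = k + 2 from rfl, Nat.add_sub_cancel] at this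
  linarith

theorem IsSolution.increment_bounds (hu : IsSolution g1 g2 n h α u) (hh : 0 < h)
    (hpos : ∀ x > (0 : ℝ), 0 < g1 x) (hm : MonotoneOn g1 (Set.Ici 0))
    {k : ℕ} (hk : 1 ≤ k) (hkn : k + 1 ≤ n) :
    0 < u (k + 1) - u k ∧ u 1 ≤ u k ∧ h ^ 2 * (k - 1 / 2) * g1 (u 1) ≤ u (k + 1) - u k ∧
      u (k + 1) - u k ≤ h ^ 2 * (k - 1 / 2) * g1 (u k) := by
  induction k, hk using Nat.le_induction with
  | base =>
    have h1 := hu.2.1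
    have hp := hpos _ (hu.1 1 le_rfl (by omega))
    have : u (1 + 1) - u 1 = h ^ 2 * (((1 : ℕ) : ℝ) - 1 / 2) * g1 (u 1) := by
      rw [show (1 + 1 : ℕ) = 2 from rfl, h1]
      push_cast
      ring
    refine ⟨?_, le_rfl, this.ge, this.le⟩
    rw [show (1 + 1 : ℕ) = 2 from rfl, h1]
    positivity
  | succ k hk ih =>
    obtain ⟨i1, i2, i3, i4⟩ := ih (by omega)
    have hs := hu.step hk hkn
    have hk0 := hu.1 k hk (by omega)
    have hk1 := hu.1 (k + 1) (by omega) (by omega)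
    have h10 := hu.1 1 le_rfl (by omega)
    have hp := hpos _ hk1
    have hh2 : 0 < h ^ 2 := by positivity
    have hle : u 1 ≤ u (k + 1) := by linarith
    have hm1 := mul_le_mul_of_nonneg_left (hm h10.le hk1.le hle) hh2.le
    have hkR : (1 : ℝ) ≤ k := by exact_mod_cast hk
    have hm2 := mul_le_mul_of_nonneg_left (hm hk0.le hk1.le (by linarith : u k ≤ u (k + 1)))
      (mul_nonneg hh2.le (by linarith : (0 : ℝ) ≤ k - 1 / 2))
    have hpp : 0 < h ^ 2 * g1 (u (k + 1)) := by positivity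
    rw [show k + 1 + 1 = k + 2 from rfl, hs]
    push_cast
    refine ⟨by linarith, hle, by linarith, by linarith⟩

theorem IsSolution.monotone (hu : IsSolution g1 g2 n h α u) (hh : 0 < h)
    (hpos : ∀ x > (0 : ℝ), 0 < g1 x) (hm : MonotoneOn g1 (Set.Ici 0))
    {j k : ℕ} (hj : 1 ≤ j) (hjk : j ≤ k) (hkn : k ≤ n) : u j ≤ u k := by
  induction k, hjk using Nat.le_induction with
  | base => exact le_rfl
  | succ k hk ih =>
    have := (hu.increment_bounds hh hpos hm (hj.trans hk) hkn).1
    linarith [ih (by omega)]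

theorem IsSolution.increment_monotone (hu : IsSolution g1 g2 n h α u) (hh : 0 < h)
    (hpos : ∀ x > (0 : ℝ), 0 < g1 x)
    {j k : ℕ} (hj : 1 ≤ j) (hjk : j ≤ k) (hkn : k + 1 ≤ n) :
    u (j + 1) - u j ≤ u (k + 1) - u k := by
  induction k, hjk using Nat.le_induction with
  | base => exact le_rfl
  | succ k hk ih =>
    have hs := hu.step (hj.trans hk) hkn
    have hp := hpos _ (hu.1 (k + 1) (by omega) (by omega))
    have : 0 < h ^ 2 * g1 (u (k + 1)) := by positivity
    rw [show k + 1 + 1 = k + 2 from rfl, hs]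
    linarith [ih (by omega)]

/-- Discrete energy estimates. -/
theorem IsSolution.energy (hu : IsSolution g1 g2 n h α u) (hh : 0 < h) (hg : Continuous g1)
    (hpos : ∀ x > (0 : ℝ), 0 < g1 x) (hm : MonotoneOn g1 (Set.Ici 0))
    {k : ℕ} (hk : 1 ≤ k) (hkn : k + 1 ≤ n) :
    2 * h ^ 2 * (primG1 g1 (u k) - primG1 g1 (u 1)) ≤ (u (k + 1) - u k) ^ 2 ∧
      (u (k + 1) - u k) ^ 2 ≤ 2 * h ^ 2 * (primG1 g1 (u (k + 1)) - primG1 g1 (u 1)) := by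
  induction k, hk using Nat.le_induction with
  | base =>
    have h1 := hu.2.1
    have h10 := hu.1 1 le_rfl (by omega)
    have hinc := (hu.increment_bounds hh hpos hm le_rfl hkn).1
    have hb := (primG1_sub_bounds hg hm h10.le (by linarith : u 1 ≤ u (1 + 1))).1
    refine ⟨by simpa using sq_nonneg (u (1 + 1) - u 1), ?_⟩
    have hp := hpos _ h10
    have hb' := mul_le_mul_of_nonneg_left hb (by positivity : 0 ≤ 2 * h ^ 2)
    have e : (u (1 + 1) - u 1) ^ 2 = h ^ 2 / 2 * (g1 (u 1) * (u (1 + 1) - u 1)) := by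
      rw [sq]
      nth_rewrite 1 [show u (1 + 1) - u 1 = h ^ 2 / 2 * g1 (u 1) from h1]
      ring
    have : 0 < h ^ 2 * (g1 (u 1) * (u (1 + 1) - u 1)) := by positivity
    rw [e]
    linarith
  | succ k hk ih =>
    obtain ⟨i1, i2⟩ := ih (by omega)
    have hs := hu.step hk hkn
    have hk0 := hu.1 k hk (by omega)
    have hk1 := hu.1 (k + 1) (by omega) (by omega)
    have a1 := (hu.increment_bounds hh hpos hm hk (by omega)).1
    have a2 := (hu.increment_bounds hh hpos hm (by omega : 1 ≤ k + 1) hkn).1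
    rw [show k + 1 + 1 = k + 2 from rfl] at *
    have hp := hpos _ hk1
    have hpp : 0 < h ^ 2 * g1 (u (k + 1)) := by positivity
    have hb1 := mul_le_mul_of_nonneg_left
      (primG1_sub_bounds hg hm hk0.le (by linarith : u k ≤ u (k + 1))).2
      (by positivity : 0 ≤ 2 * h ^ 2)
    have hb2 := mul_le_mul_of_nonneg_left
      (primG1_sub_bounds hg hm hk1.le (by linarith : u (k + 1) ≤ u (k + 2))).1
      (by positivity : 0 ≤ 2 * h ^ 2)
    have e : (u (k + 2) - u (k + 1)) ^ 2 = (u (k + 1) - u k) ^ 2 +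
        h ^ 2 * g1 (u (k + 1)) * ((u (k + 2) - u (k + 1)) + (u (k + 1) - u k)) := by
      rw [hs]
      ring
    have hmul := mul_le_mul_of_nonneg_left
      (by linarith : u (k + 1) - u k ≤ u (k + 2) - u (k + 1)) hpp.le
    rw [e]
    constructor <;> linarith

/-- The boundary flux of a solution: it lies between the values of `g₁` at the two ends, and
dominates the last increment and the energy. -/
theorem IsSolution.flux (hu : IsSolution g1 g2 n h α u) (hh : 0 < h) (hg : Continuous g1)
    (hpos : ∀ x > (0 : ℝ), 0 < g1 x) (hm : MonotoneOn g1 (Set.Ici 0)) (hn : 2 ≤ n)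
    (hhn : h * (n - 1) = 1) :
    g1 (u 1) ≤ α * g2 (u n) ∧ α * g2 (u n) ≤ g1 (u n) ∧
      u n - u (n - 1) ≤ h * (α * g2 (u n)) ∧
      primG1 g1 (u n) - primG1 g1 (u 1) ≤ (α * g2 (u n)) ^ 2 := by
  obtain ⟨k, rfl⟩ : ∃ k, n = k + 1 := ⟨n - 1, by omega⟩
  have hk : 1 ≤ k := by omega
  obtain ⟨b0, b1, b2, b3⟩ := hu.increment_bounds hh hpos hm hk le_rfl
  obtain ⟨e1, -⟩ := hu.energy hh hg hpos hm hk le_rfl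
  have hl := hu.2.2.2
  rw [Nat.add_sub_cancel] at *
  push_cast at hhn
  have hhk : h * k = 1 := by linarith
  have hk0 := hu.1 k hk (by omega)
  have hk1 := hu.1 (k + 1) (by omega) le_rfl
  have h10 := hu.1 1 le_rfl (by omega)
  have hp := hpos _ hk1
  have m1 := hm hk0.le hk1.le (by linarith)
  have m2 := hm h10.le hk1.le (by linarith)
  set p := α * g2 (u (k + 1)) with hpdef
  set a := u (k + 1) - u k with ha
  have hpa : h * p = a + h ^ 2 / 2 * g1 (u (k + 1)) := by rw [hpdef]; linarith
  have hh2 : 0 < h ^ 2 := by positivity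
  have hkR : (1 : ℝ) ≤ k := by exact_mod_cast hk
  have hhk2 : h ^ 2 * (k : ℝ) = h := by rw [sq, mul_assoc, hhk, mul_one]
  have c1 : h ^ 2 * ((k : ℝ) - 1 / 2) = h - h ^ 2 / 2 := by rw [mul_sub, hhk2]; ring
  rw [c1] at b2 b3
  have c2 : 0 ≤ h - h ^ 2 / 2 := by
    rw [← c1]
    exact mul_nonneg hh2.le (by linarith)
  have m1' := mul_le_mul_of_nonneg_left m1 c2
  have m2' := mul_le_mul_of_nonneg_left m2 hh2.le
  refine ⟨?_, ?_, ?_, ?_⟩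
  · refine le_of_mul_le_mul_left ?_ hh
    linarith
  · refine le_of_mul_le_mul_left ?_ hh
    linarith
  · have : 0 < h ^ 2 / 2 * g1 (u (k + 1)) := by positivity
    linarith
  · refine le_of_mul_le_mul_left ?_ hh2
    have hb := mul_le_mul_of_nonneg_left
      (primG1_sub_bounds hg hm hk0.le (by linarith : u k ≤ u (k + 1))).2 hh2.le
    have hmono := (primG1_sub_bounds hg hm h10.le b1).1
    have hg10 := hpos _ h10
    have : 0 ≤ h ^ 2 * (g1 (u 1) * (u k - u 1)) :=
      mul_nonneg hh2.le (mul_nonneg hg10.le (by linarith))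
    have hmono' := mul_le_mul_of_nonneg_left hmono hh2.le
    have e : h ^ 2 * p ^ 2 = a ^ 2 + h ^ 2 * (g1 (u (k + 1)) * a)
        + (h ^ 2 / 2 * g1 (u (k + 1))) ^ 2 := by
      rw [← mul_pow, hpa]
      ring
    have := sq_nonneg (h ^ 2 / 2 * g1 (u (k + 1)))
    rw [e]
    linarith

/-- Geometric growth bound for solutions along which `g₁` is bounded by a linear function. -/
theorem IsSolution.last_le_exp (hu : IsSolution g1 g2 n h α u) (hh : 0 < h)
    (hpos : ∀ x > (0 : ℝ), 0 < g1 x) (hm : MonotoneOn g1 (Set.Ici 0)) (hn : 2 ≤ n)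
    (hhn : h * (n - 1) = 1) {K : ℝ}
    (hlin : ∀ k, 1 ≤ k → k ≤ n → g1 (u k) ≤ K * u k) : u n ≤ Real.exp K * u 1 := by
  have key : ∀ k, k + 1 ≤ n → u (k + 1) ≤ Real.exp (h * K) ^ k * u 1 := by
    intro k
    induction k with
    | zero => intro _; simp
    | succ k ih =>
      intro hkn
      have hb := (hu.increment_bounds hh hpos hm (by omega : 1 ≤ k + 1) hkn).2.2.2
      have hk1 := hu.1 (k + 1) (by omega) (by omega)
      have hle : h ^ 2 * (((k + 1 : ℕ) : ℝ) - 1 / 2) ≤ h := by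
        have hkn' : ((k + 1 : ℕ) : ℝ) + 1 ≤ n := by exact_mod_cast hkn
        have := mul_le_mul_of_nonneg_left
          (by linarith : ((k + 1 : ℕ) : ℝ) - 1 / 2 ≤ n - 1) (by positivity : 0 ≤ h ^ 2)
        rwa [sq h, mul_assoc h h ((n : ℝ) - 1), hhn, mul_one, ← sq] at this
      have h1 := mul_le_mul_of_nonneg_right hle (hpos _ hk1).le
      have h2 := mul_le_mul_of_nonneg_left (hlin (k + 1) (by omega) (by omega)) hh.le
      have h3 := mul_le_mul_of_nonneg_right (Real.add_one_le_exp (h * K)) hk1.le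
      have h4 := mul_le_mul_of_nonneg_left (ih (by omega)) (Real.exp_pos (h * K)).le
      calc u (k + 1 + 1) ≤ Real.exp (h * K) * u (k + 1) := by linarith
        _ ≤ _ := by rw [pow_succ]; linarith
  obtain ⟨k, rfl⟩ : ∃ k, n = k + 1 := ⟨n - 1, by omega⟩
  have := key k le_rfl
  rw [← Real.exp_nat_mul] at this
  push_cast at hhn
  rwa [show (k : ℝ) * (h * K) = K by linear_combination K * hhn] at this

/-- Every row of the Jacobian is positive on the vector `g2 ∘ u`, given Taylor bounds for `g2`, the
supersolution inequality and smallness of the discretization error. -/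
theorem IsSolution.jacobian_row_pos (hu : IsSolution g1 g2 n h α u) (hh : 0 < h)
    (hg : Continuous g1) (hpos : ∀ x > (0 : ℝ), 0 < g1 x) (hm : MonotoneOn g1 (Set.Ici 0))
    (hpos2 : ∀ x > (0 : ℝ), 0 < deriv g2 x)
    (hconv2 : ∀ x > (0 : ℝ), 0 < deriv (deriv g2) x) (hn : 2 ≤ n) {d S P : ℝ} (hd : d < 1)
    (key : ∀ x > (0 : ℝ), deriv g2 x * g1 x + 2 * deriv (deriv g2) x * primG1 g1 x
      + 3 * (1 - d) * (g1 x * deriv g2 x) ≤ deriv g1 x * g2 x)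
    (hG1 : ∀ x > (0 : ℝ), 0 < primG1 g1 x)
    (hP : u n - u (n - 1) ≤ h * P)
    (fwd : ∀ x y, u 1 ≤ x → x ≤ y → y ≤ u n → g2 y ≤ g2 x + deriv g2 x * (y - x)
      + (deriv (deriv g2) x + S * (y - x)) / 2 * (y - x) ^ 2)
    (bwd : ∀ x y, 0 < y → y ≤ x → g2 y ≤ g2 x + deriv g2 x * (y - x)
      + deriv (deriv g2) x / 2 * (y - x) ^ 2)
    (hS : 0 ≤ S)
    (small : ∀ x a, u 1 ≤ x → x ≤ u n → 0 ≤ a → a ≤ h * P →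
      h ^ 2 * (deriv (deriv g2) x * g1 x) * a + S * a ^ 3
        < 3 * (1 - d) * (h ^ 2 * (g1 x * deriv g2 x))) (i : Fin n) :
    0 < ∑ j, Jmat g1 g2 n h α u i j * g2 (u ((j : ℕ) + 1)) := by
  have hh2 : 0 < h ^ 2 := by positivity
  have hale : ∀ k, 1 ≤ k → k + 1 ≤ n → u (k + 1) - u k ≤ h * P := by
    intro k hk hkn
    have := hu.increment_monotone hh hpos hk (by omega : k ≤ n - 1) (by omega)
    rw [show n - 1 + 1 = n by omega] at this
    exact this.trans hP
  rw [sum_Jmat_row hn i fun k => g2 (u k)]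
  have h10 := hu.1 1 le_rfl (by omega)
  split_ifs with hi0 hin
  · have b := (hu.increment_bounds hh hpos hm le_rfl (by omega : 1 + 1 ≤ n)).1
    have hmon := hu.monotone hh hpos hm (by norm_num : 1 ≤ 2) hn le_rfl
    have h2 := hu.2.1
    have hf := fwd (u 1) (u 2) le_rfl (by linarith) hmon
    have hs := small (u 1) (u 2 - u 1) le_rfl (by linarith) b.le (hale 1 le_rfl hn)
    have hk := mul_le_mul_of_nonneg_left (key _ h10) hh2.le
    set a := u 2 - u 1 with ha
    have hsq : a ^ 2 = h ^ 2 / 2 * g1 (u 1) * a := by rw [sq, ← h2]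
    have e : deriv (deriv g2) (u 1) * a ^ 2 = h ^ 2 / 2 * (deriv (deriv g2) (u 1) * g1 (u 1)) * a :=
      by rw [hsq]; ring
    have e2 : deriv g2 (u 1) * a = h ^ 2 / 2 * (deriv g2 (u 1) * g1 (u 1)) := by rw [h2]; ring
    have p1 : 0 < h ^ 2 * (deriv (deriv g2) (u 1) * g1 (u 1)) * a := by
      have := hconv2 _ h10
      have := hpos _ h10
      have : 0 < a := b
      positivity
    have p2 : 0 ≤ h ^ 2 * (deriv (deriv g2) (u 1) * primG1 g1 (u 1)) := by
      have := hconv2 _ h10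
      have := hG1 _ h10
      positivity
    nlinarith
  · have hnn : n - 1 + 1 = n := by omega
    have hn0 := hu.1 n (by omega) le_rfl
    have b := (hu.increment_bounds hh hpos hm (by omega : 1 ≤ n - 1) hnn.le).1
    have en := (hu.energy hh hg hpos hm (by omega : 1 ≤ n - 1) hnn.le).2
    rw [hnn] at b en
    have hb := bwd (u n) (u (n - 1)) (hu.1 (n - 1) (by omega) (by omega)) (by linarith)
    have hl := hu.2.2.2
    have hk := mul_le_mul_of_nonneg_left (key _ hn0) hh2.le
    have hG := hG1 _ h10
    have hc := hconv2 _ hn0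
    have e : deriv (deriv g2) (u n) / 2 * (u (n - 1) - u n) ^ 2
        ≤ h ^ 2 * (deriv (deriv g2) (u n) * primG1 g1 (u n)) := by
      have : (u (n - 1) - u n) ^ 2 ≤ 2 * h ^ 2 * primG1 g1 (u n) := by
        have := mul_pos hh2 hG
        rw [← neg_sub, neg_sq]
        linarith
      have := mul_le_mul_of_nonneg_left this (by positivity : 0 ≤ deriv (deriv g2) (u n) / 2)
      linarith
    have e2 : deriv g2 (u n) * (u (n - 1) - u n)
        = h ^ 2 / 2 * (deriv g2 (u n) * g1 (u n)) - h * α * deriv g2 (u n) * g2 (u n) := by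
      rw [← neg_sub, hl]
      ring
    have p1 : 0 < (1 - d) * (h ^ 2 * (g1 (u n) * deriv g2 (u n))) := by
      have := hpos _ hn0
      have := hpos2 _ hn0
      have : 0 < 1 - d := by linarith
      positivity
    rw [e2] at hb
    linarith
  · obtain ⟨k, hk⟩ : ∃ k, (i : ℕ) = k + 1 := ⟨i - 1, by omega⟩
    have hkn : k + 3 ≤ n := by omega
    rw [hk, show k + 1 + 1 = k + 2 from rfl, show k + 1 + 2 = k + 3 from rfl]
    have b1 := (hu.increment_bounds hh hpos hm (by omega : 1 ≤ k + 1) (by omega)).1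
    have b2 := (hu.increment_bounds hh hpos hm (by omega : 1 ≤ k + 2) hkn).1
    have hs := hu.step (by omega : 1 ≤ k + 1) hkn
    have en := (hu.energy hh hg hpos hm (by omega : 1 ≤ k + 1) (by omega)).2
    have al := hale (k + 2) (by omega) hkn
    rw [show k + 1 + 1 = k + 2 from rfl] at *
    rw [show k + 1 + 2 = k + 3 from rfl] at *
    rw [show k + 2 + 1 = k + 3 from rfl] at *
    have hx0 := hu.1 (k + 2) (by omega) (by omega)
    have hz0 := hu.1 (k + 1) (by omega) (by omega)
    have m1 := hu.monotone hh hpos hm le_rfl (by omega : 1 ≤ k + 2) (by omega)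
    have m2 := hu.monotone hh hpos hm (by omega : 1 ≤ k + 3) hkn le_rfl
    have hf := fwd (u (k + 2)) (u (k + 3)) m1 (by linarith) m2
    have hb := bwd (u (k + 2)) (u (k + 1)) hz0 (by linarith)
    have hsm := small (u (k + 2)) _ m1 (by linarith) b2.le al
    have hky := mul_le_mul_of_nonneg_left (key _ hx0) hh2.le
    have hc := hconv2 _ hx0
    have hp := hpos _ hx0
    have hG := mul_pos hh2 (hG1 _ h10)
    rw [← neg_sub (u (k + 2)) (u (k + 1))] at hb
    set x := u (k + 2)
    set a := u (k + 3) - x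
    set b := x - u (k + 1)
    have hgp : 0 < h ^ 2 * g1 x := by positivity
    have q1 : a ^ 2 + b ^ 2 ≤ 2 * (2 * h ^ 2 * primG1 g1 x) + 2 * (h ^ 2 * g1 x * a) := by
      have : a ^ 2 = b ^ 2 + h ^ 2 * g1 x * (a + b) := by rw [hs]; ring
      have hba := mul_le_mul_of_nonneg_left (by linarith : b ≤ a) hgp.le
      linarith
    have q2 := mul_le_mul_of_nonneg_left q1 (by positivity : 0 ≤ deriv (deriv g2) x / 2)
    have q3 : deriv g2 x * a = deriv g2 x * b + h ^ 2 * (deriv g2 x * g1 x) := by rw [hs]; ring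
    have q4 : 0 ≤ S * a ^ 3 := by positivity
    nlinarith

end Solution

/-- An upper bound for the right end value, from the energy and flux estimates. -/
theorem exists_last_bound {g1 g2 : ℝ → ℝ} {α : ℝ} (hα : 0 < α)
    (hpos : ∀ x > (0 : ℝ), 0 < g2 x) (hm : MonotoneOn g2 (Set.Ici 0))
    (hgmono : StrictMonoOn (gg g1 g2) (Set.Ioi 0))
    (hgbij : Set.BijOn (gg g1 g2) (Set.Ioi 0) (Set.Ioi 0))
    (hGmono : StrictMonoOn (GG g1 g2) (Set.Ioi 0))
    (hGbij : Set.BijOn (GG g1 g2) (Set.Ioi 0) (Set.Ioi 0)) :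
    ∃ C > (0 : ℝ), ∀ x y, 0 < x → x ≤ y → g1 x ≤ α * g2 y →
      primG1 g1 y - primG1 g1 x ≤ (α * g2 y) ^ 2 → y ≤ C := by
  obtain ⟨a, ha, hga⟩ := hgbij.surjOn (show 2 * α ∈ Set.Ioi (0 : ℝ) from by simpa using hα)
  have hGa : 0 < GG g1 g2 a := hGbij.mapsTo ha
  obtain ⟨C, hC, hGC⟩ := hGbij.surjOn
    (show 3 * α ^ 2 + GG g1 g2 a ∈ Set.Ioi (0 : ℝ) from Set.mem_Ioi.2 (by positivity))
  refine ⟨C, hC, fun x y hx hxy hflux hen => ?_⟩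
  have hy : 0 < y := hx.trans_le hxy
  have hx2 := hpos x hx
  have hy2 := hpos y hy
  have hle := hm hx.le hy.le hxy
  have hGx : 0 < GG g1 g2 x := hGbij.mapsTo hx
  have ex : primG1 g1 x = GG g1 g2 x * g2 x ^ 2 := by rw [GG]; field_simp
  have ey : primG1 g1 y = GG g1 g2 y * g2 y ^ 2 := by rw [GG]; field_simp
  have hsq : g2 x ^ 2 ≤ g2 y ^ 2 := pow_le_pow_left₀ hx2.le hle 2
  have hmonG := hGmono.monotoneOn hx hy hxy
  rw [ex, ey, mul_pow] at hen
  have h1 : GG g1 g2 y ≤ α ^ 2 + GG g1 g2 x := by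
    refine le_of_mul_le_mul_right ?_ (by positivity : 0 < g2 y ^ 2)
    have := mul_le_mul_of_nonneg_left hsq hGx.le
    linarith
  refine (hGmono.le_iff_le hy hC).1 ?_
  rw [hGC]
  rcases le_total (GG g1 g2 x) (2 * α ^ 2) with hcase | hcase
  · linarith
  · have h2 : g2 y ^ 2 ≤ 2 * g2 x ^ 2 := by
      refine le_of_mul_le_mul_left ?_ (by positivity : 0 < α ^ 2)
      have i1 := mul_le_mul_of_nonneg_right hmonG (by positivity : 0 ≤ g2 y ^ 2)
      have i2 := mul_le_mul_of_nonneg_right hcase (sub_nonneg.2 hsq)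
      linarith
    have h3 : g2 y ≤ 2 * g2 x := by
      refine (pow_le_pow_iff_left₀ hy2.le (by positivity) two_ne_zero).1 ?_
      nlinarith [sq_nonneg (g2 x)]
    have h4 : gg g1 g2 x ≤ gg g1 g2 a := by
      rw [hga, gg, div_le_iff₀ hx2]
      have := mul_le_mul_of_nonneg_left h3 hα.le
      linarith
    have h5 := hGmono.monotoneOn hx ha ((hgmono.le_iff_le hx ha).1 h4)
    linarith [sq_nonneg α]

theorem Jmat_isSymm (g1 g2 : ℝ → ℝ) (n : ℕ) (h α : ℝ) (u : ℕ → ℝ) :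
    (Jmat g1 g2 n h α u).IsSymm := by
  ext i j
  simp only [Jmat, Matrix.transpose_apply, Matrix.of_apply]
  rcases eq_or_ne i j with rfl | hij
  · rfl
  · simp only [if_neg hij, if_neg hij.symm, or_comm]

theorem stmt_16
    (g1 g2 : ℝ → ℝ)
    (hg1C : ContDiff ℝ 3 g1) (hg2C : ContDiff ℝ 3 g2)
    (hg10 : g1 0 = 0) (hg20 : g2 0 = 0)
    (hg1d : ∀ x > (0:ℝ), 0 < deriv g1 x) (hg2d : ∀ x > (0:ℝ), 0 < deriv g2 x)
    (hg1dd : ∀ x > (0:ℝ), 0 < deriv (deriv g1) x)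
    (hg2dd : ∀ x > (0:ℝ), 0 < deriv (deriv g2) x)
    (hg1ddd : ∀ x > (0:ℝ), 0 ≤ deriv (deriv (deriv g1)) x)
    (hg2ddd : ∀ x > (0:ℝ), 0 ≤ deriv (deriv (deriv g2)) x)
    (α : ℝ) (hα : 0 < α)
    (hgmono : StrictMonoOn (gg g1 g2) (Set.Ioi 0))
    (hgbij : Set.BijOn (gg g1 g2) (Set.Ioi 0) (Set.Ioi 0))
    (hGmono : StrictMonoOn (GG g1 g2) (Set.Ioi 0))
    (hGbij : Set.BijOn (GG g1 g2) (Set.Ioi 0) (Set.Ioi 0))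
    (d : ℝ) (hd0 : 0 ≤ d) (hd1 : d < 1)
    (hH2 : ∀ x > (0:ℝ), 0 ≤ d * g1 x / primG1 g1 x - 2 * deriv g2 x / g2 x)
    (hH3 : ∀ x > (0:ℝ), 0 ≤ deriv (deriv (GG g1 g2)) x) :
    ∃ M > (0:ℝ), ∀ n : ℕ, 1 + M / (2 - 2 * d) < (n : ℝ) →
      ∀ u : ℕ → ℝ, IsSolution g1 g2 n (1 / ((n : ℝ) - 1)) α u →
        (Jmat g1 g2 n (1 / ((n : ℝ) - 1)) α u).IsSymm ∧
        (Jmat g1 g2 n (1 / ((n : ℝ) - 1)) α u).PosDef := by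
  have hg1 : Differentiable ℝ g1 := hg1C.differentiable (by norm_num)
  have hg2 : Differentiable ℝ g2 := hg2C.differentiable (by norm_num)
  have hg1C' : ContDiff ℝ 2 (deriv g1) := ((contDiff_succ_iff_deriv (n := 2)).1 hg1C).2.2
  have hg2C' : ContDiff ℝ 2 (deriv g2) := ((contDiff_succ_iff_deriv (n := 2)).1 hg2C).2.2
  have hg2C'' : ContDiff ℝ 1 (deriv (deriv g2)) :=
    ((contDiff_succ_iff_deriv (n := 1)).1 hg2C').2.2
  have hg1' : Differentiable ℝ (deriv g1) := hg1C'.differentiable (by norm_num)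
  have hg2' : Differentiable ℝ (deriv g2) := hg2C'.differentiable (by norm_num)
  have hg2'' : Differentiable ℝ (deriv (deriv g2)) := hg2C''.differentiable (by norm_num)
  have hcont : Continuous g1 := hg1.continuous
  have m1 := monotoneOn_Ici_of_deriv_pos hg1 fun x hx => (hg1d x hx).le
  have m1' := monotoneOn_Ici_of_deriv_pos hg1' fun x hx => (hg1dd x hx).le
  have m2 := monotoneOn_Ici_of_deriv_pos hg2 fun x hx => (hg2d x hx).le
  have m2' := monotoneOn_Ici_of_deriv_pos hg2' fun x hx => (hg2dd x hx).le
  have m2'' := monotoneOn_Ici_of_deriv_pos hg2'' hg2ddd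
  have p1 : ∀ x > (0 : ℝ), 0 < g1 x := fun x hx => pos_of_deriv_pos hg1 hg10 hg1d hx
  have p2 : ∀ x > (0 : ℝ), 0 < g2 x := fun x hx => pos_of_deriv_pos hg2 hg20 hg2d hx
  have pG : ∀ x > (0 : ℝ), 0 < primG1 g1 x := fun x hx =>
    pos_of_deriv_pos (fun y => (hasDerivAt_primG1 hcont y).differentiableAt) (by simp [primG1])
      (fun y hy => by rw [(hasDerivAt_primG1 hcont y).deriv]; exact p1 y hy) hx
  have key := fun x (hx : x > (0 : ℝ)) =>
    supersolution_inequality hcont hg1 hg2 hg2' p2 hg2d pG hH2 hH3 hx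
  obtain ⟨C, hC, hlast⟩ := exists_last_bound hα p2 m2 hgmono hgbij hGmono hGbij
  obtain ⟨v, hv, hgv⟩ := hgbij.surjOn (show α ∈ Set.Ioi (0 : ℝ) from hα)
  have hv0 : 0 < v := hv
  set K := deriv g1 C
  set c := Real.exp (-K) * v with hcdef
  have hc : 0 < c := by positivity
  set P := α * g2 C
  have hP : 0 < P := mul_pos hα (p2 C hC)
  obtain ⟨S, hS0, hS⟩ : ∃ S : ℝ, 0 ≤ S ∧
      ∀ t ∈ Set.Icc c C, deriv (deriv (deriv g2)) t ≤ S := by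
    obtain ⟨S, hS⟩ := isCompact_Icc.exists_bound_of_continuousOn
      (hg2C''.continuous_deriv le_rfl).continuousOn (s := Set.Icc c C)
    exact ⟨max S 0, le_max_right _ _, fun t ht =>
      ((le_abs_self _).trans (hS t ht)).trans (le_max_left _ _)⟩
  set B := deriv (deriv g2) C * g1 C
  have hB : 0 < B := mul_pos (hg2dd C hC) (p1 C hC)
  set m := g1 c * deriv g2 c
  have hm : 0 < m := mul_pos (p1 c hc) (hg2d c hc)
  refine ⟨(B * P + S * P ^ 3) / m + 1, by positivity, fun n hn u hu =>
    ⟨Jmat_isSymm _ _ _ _ _ _, ?_⟩⟩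
  have hd2 : 0 < 2 - 2 * d := by linarith
  have hn1 : 0 < (n : ℝ) - 1 := by
    have : 0 < ((B * P + S * P ^ 3) / m + 1) / (2 - 2 * d) := by positivity
    linarith
  have hn2 : 2 ≤ n := by
    have : (1 : ℝ) < n := by linarith
    exact_mod_cast this
  set h := 1 / ((n : ℝ) - 1) with hdef
  have hh : 0 < h := by positivity
  have hhn : h * ((n : ℝ) - 1) = 1 := by rw [hdef]; field_simp
  have hsmall : h * (B * P + S * P ^ 3) < (2 - 2 * d) * m := by
    have h1 := lt_sub_iff_add_lt'.2 hn
    rw [div_lt_iff₀ hd2] at h1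
    have h2 : (B * P + S * P ^ 3) / m < ((n : ℝ) - 1) * (2 - 2 * d) := by linarith
    rw [div_lt_iff₀ hm] at h2
    have h3 := mul_lt_mul_of_pos_left h2 hh
    rwa [mul_assoc ((n : ℝ) - 1), ← mul_assoc h, hhn, one_mul] at h3
  obtain ⟨f1, f2, f3, f4⟩ := hu.flux hh hcont p1 m1 hn2 hhn
  have h1pos := hu.1 1 le_rfl (by omega)
  have hnpos := hu.1 n (by omega) le_rfl
  have hmon : ∀ {j k}, 1 ≤ j → j ≤ k → k ≤ n → u j ≤ u k := fun hj hjk hk =>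
    hu.monotone hh p1 m1 hj hjk hk
  have hunC : u n ≤ C := hlast (u 1) (u n) h1pos (hmon le_rfl (by omega) le_rfl) f1 f4
  have hvn : v ≤ u n := by
    refine (hgmono.le_iff_le hv hnpos).1 ?_
    rw [hgv, gg, le_div_iff₀ (p2 _ hnpos)]
    exact f2
  have hcu : c ≤ u 1 := by
    have h1 := hu.last_le_exp hh p1 m1 hn2 hhn (K := K) fun k hk hkn => by
      have hk0 := hu.1 k hk hkn
      obtain ⟨ξ, hξ, hξe⟩ := exists_deriv_eq_slope g1 hk0 hcont.continuousOn hg1.differentiableOn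
      rw [hg10, sub_zero, sub_zero, eq_div_iff hk0.ne'] at hξe
      rw [← hξe]
      exact mul_le_mul_of_nonneg_right
        (m1' hξ.1.le hC.le (hξ.2.le.trans ((hmon hk hkn le_rfl).trans hunC))) hk0.le
    rw [hcdef, Real.exp_neg, inv_mul_le_iff₀ (Real.exp_pos K)]
    exact hvn.trans h1
  refine posDef_of_pos_mulVec _ (Jmat_isSymm _ _ _ _ _ _) ?_
    (fun j : Fin n => g2 (u ((j : ℕ) + 1))) (fun j => p2 _ (hu.1 _ (by omega) (by omega))) ?_
  · intro i j hij
    simp only [Jmat, Matrix.of_apply, if_neg hij]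
    split_ifs <;> norm_num
  refine hu.jacobian_row_pos hh hcont p1 m1 hg2d hg2dd hn2 hd1 key pG (S := S) (P := P) ?_ ?_ ?_
    hS0 ?_
  · refine f3.trans (mul_le_mul_of_nonneg_left ?_ hh.le)
    exact mul_le_mul_of_nonneg_left (m2 hnpos.le hC.le hunC) hα.le
  · intro x y hx hxy hy
    refine le_quadratic_of_second_deriv_le (hg2C.of_le (by norm_num)) fun t ht => ?_
    rw [Set.uIcc_of_le hxy] at ht
    have h1 := (convex_Icc c C).image_sub_le_mul_sub_of_deriv_le
      hg2''.continuous.continuousOn hg2''.differentiableOn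
      (fun z hz => hS z (interior_subset hz)) x ⟨by linarith, by linarith⟩ t
      ⟨by linarith [ht.1], by linarith [ht.2]⟩ ht.1
    have h2 := mul_le_mul_of_nonneg_left (sub_le_sub_right ht.2 x) hS0
    linarith
  · intro x y hy hyx
    refine le_quadratic_of_second_deriv_le (hg2C.of_le (by norm_num)) fun t ht => ?_
    rw [Set.uIcc_of_ge hyx] at ht
    exact m2'' (hy.le.trans ht.1) (hy.le.trans hyx) ht.2
  · intro x a hx hxn ha haP
    have hx0 : 0 < x := by linarith
    have b1 : deriv (deriv g2) x * g1 x ≤ B :=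
      mul_le_mul (m2'' hx0.le hC.le (by linarith)) (m1 hx0.le hC.le (by linarith)) (p1 x hx0).le
        (hg2dd C hC).le
    have b2 : m ≤ g1 x * deriv g2 x :=
      mul_le_mul (m1 hc.le hx0.le (by linarith)) (m2' hc.le hx0.le (by linarith)) (hg2d c hc).le
        (p1 x hx0).le
    have hh2 : 0 < h ^ 2 := by positivity
    calc h ^ 2 * (deriv (deriv g2) x * g1 x) * a + S * a ^ 3
        ≤ h ^ 2 * B * (h * P) + S * (h * P) ^ 3 := by gcongr
      _ = h ^ 2 * (h * (B * P + S * P ^ 3)) := by ring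
      _ < h ^ 2 * ((2 - 2 * d) * m) := mul_lt_mul_of_pos_left hsmall hh2
      _ ≤ h ^ 2 * (3 * (1 - d) * m) := by
          refine mul_le_mul_of_nonneg_left (mul_le_mul_of_nonneg_right ?_ hm.le) hh2.le
          linarith
      _ ≤ h ^ 2 * (3 * (1 - d) * (g1 x * deriv g2 x)) := by
          refine mul_le_mul_of_nonneg_left (mul_le_mul_of_nonneg_left b2 ?_) hh2.le
          linarith
      _ = 3 * (1 - d) * (h ^ 2 * (g1 x * deriv g2 x)) := by ring
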